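/- Assume f₀ : 𝒳ⁿ → ℝⁿ is Lipschitz on bounded sets with f₀(0) = 0. Suppose there exist a continuously differentiable V : ℝⁿ → [0,∞) and α₁, α₂ of class 𝒦∞ with α₁(|z|) ≤ V(z) ≤ α₂(|z|) for all z ∈ ℝⁿ, and suppose there exist α of class 𝒫 and γ of class 𝒦 such that for all φ ∈ 𝒳ⁿ: ∇V(φ(0)) · f₀(φ) ≤ −α(V(φ(0))) + γ(max_{τ∈[-Δ,0]} V(φ(τ))). If the function s ↦ α(s) − γ(s) is of class 𝒫 (i.e., α(s) > γ(s) for all s > 0), then the system ẋ(t) = f₀(x_t) is GAS. -/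

import Mathlib

open Set Filter MeasureTheory Topology
open scoped NNReal

noncomputable section

/-- `ℝⁿ` with the Euclidean norm. -/
abbrev Vec (n : ℕ) : Type := EuclideanSpace ℝ (Fin n)

/-- The state space `𝒳ⁿ = C([-Δ,0], ℝⁿ)`, equipped with the sup norm. -/
abbrev Hist (Δ : ℝ≥0) (n : ℕ) : Type :=
  ContinuousMap (Icc (-(Δ : ℝ)) (0 : ℝ)) (Vec n)

theorem zero_mem_IccD (Δ : ℝ≥0) : (0 : ℝ) ∈ Icc (-(Δ : ℝ)) (0 : ℝ) :=
  ⟨neg_nonpos.mpr Δ.coe_nonneg, le_refl 0⟩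

/-- `φ(0)`: the current value of a history segment. -/
def ev0 {Δ : ℝ≥0} {n : ℕ} (φ : Hist Δ n) : Vec n :=
  φ ⟨0, zero_mem_IccD Δ⟩

/-! ### Comparison functions -/

/-- Class `𝒦`: continuous, strictly increasing, zero at zero (on `[0,∞)`). -/
def ClassK (α : ℝ → ℝ) : Prop :=
  ContinuousOn α (Ici 0) ∧ StrictMonoOn α (Ici 0) ∧ α 0 = 0

/-- Class `𝒦∞`: class `𝒦` and unbounded. -/
def ClassKinf (α : ℝ → ℝ) : Prop :=
  ClassK α ∧ Tendsto α atTop atTop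

/-- Class `𝒩`: continuous, nondecreasing, zero at zero (on `[0,∞)`). -/
def ClassN (α : ℝ → ℝ) : Prop :=
  ContinuousOn α (Ici 0) ∧ MonotoneOn α (Ici 0) ∧ α 0 = 0

/-- Class `𝒫`: continuous, zero at zero, positive on `(0,∞)`. -/
def ClassP (α : ℝ → ℝ) : Prop :=
  ContinuousOn α (Ici 0) ∧ α 0 = 0 ∧ ∀ s : ℝ, 0 < s → 0 < α s

/-- Class `𝒦ℒ`. -/
def ClassKL (β : ℝ → ℝ → ℝ) : Prop :=
  (∀ t : ℝ, 0 ≤ t → ClassK fun s => β s t) ∧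
    ∀ s : ℝ, 0 ≤ s →
      ContinuousOn (β s) (Ici 0) ∧ AntitoneOn (β s) (Ici 0) ∧
        Tendsto (β s) atTop (𝓝 0)

/-! ### Inputs -/

/-- Admissible input: Lebesgue measurable and locally essentially bounded. -/
def IsInput {m : ℕ} (u : ℝ → Vec m) : Prop :=
  Measurable u ∧ ∀ T : ℝ, 0 < T → ∃ C : ℝ, ∀ᵐ t ∂volume, t ∈ Icc (0 : ℝ) T → ‖u t‖ ≤ C

/-- Essential supremum of `‖u‖` over a set of times. -/
def essBnd {m : ℕ} (u : ℝ → Vec m) (s : Set ℝ) : ℝ :=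
  sInf {C : ℝ | 0 ≤ C ∧ ∀ᵐ τ ∂volume, τ ∈ s → ‖u τ‖ ≤ C}

/-! ### History segments along a trajectory -/

-- The history segment `x_t ∈ 𝒳ⁿ` of a trajectory `x : ℝ → ℝⁿ` (with junk value `0`
-- when `x` is not continuous on `[t-Δ, t]`).
open Classical in
def seg (Δ : ℝ≥0) {n : ℕ} (x : ℝ → Vec n) (t : ℝ) : Hist Δ n :=
  if hx : ContinuousOn x (Icc (t - (Δ : ℝ)) t) then
    { toFun := fun τ => x (t + τ.1)
      continuous_toFun := by
        have h1 : Continuous fun τ : Icc (-(Δ : ℝ)) (0 : ℝ) => t + τ.1 :=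
          continuous_const.add continuous_subtype_val
        have h2 : ∀ τ : Icc (-(Δ : ℝ)) (0 : ℝ), t + τ.1 ∈ Icc (t - (Δ : ℝ)) t := by
          rintro ⟨τ, hτ⟩
          rw [mem_Icc] at hτ ⊢
          constructor
          · linarith [hτ.1]
          · linarith [hτ.2]
        exact hx.comp_continuous h1 h2 }
  else 0

/-! ### Driver's derivative and Dini derivative -/

/-- The deformed history `φ_{h,w}` appearing in Driver's derivative: for `0 ≤ h < Δ`,
`φ_{h,w}(s) = φ(s+h)` for `s ∈ [-Δ,-h)` and `φ_{h,w}(s) = φ(0) + w(h+s)` for `s ∈ [-h,0]`. -/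
def shiftSeg {Δ : ℝ≥0} {n : ℕ} (φ : Hist Δ n) (w : Vec n) (h : ℝ) : Hist Δ n :=
  { toFun := fun s =>
      φ (projIcc (-(Δ : ℝ)) 0 (neg_nonpos.mpr Δ.coe_nonneg) (s.1 + h)) + max (h + s.1) 0 • w
    continuous_toFun := by
      refine Continuous.add ?_ ?_
      · exact φ.continuous.comp (continuous_projIcc.comp
          (continuous_subtype_val.add continuous_const))
      · exact ((continuous_const.add continuous_subtype_val).max continuous_const).smul
          continuous_const }

/-- Driver's derivative `D⁺V(φ,w)`, valued in the extended reals. -/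
def driverD {Δ : ℝ≥0} {n : ℕ} (V : Hist Δ n → ℝ) (φ : Hist Δ n) (w : Vec n) : EReal :=
  limsup (fun h : ℝ => (((V (shiftSeg φ w h) - V φ) / h : ℝ) : EReal)) (𝓝[>] (0 : ℝ))

/-- Upper right-hand Dini derivative of `ν : ℝ → ℝ`, valued in the extended reals. -/
def diniD (ν : ℝ → ℝ) (t : ℝ) : EReal :=
  limsup (fun h : ℝ => (((ν (t + h) - ν t) / h : ℝ) : EReal)) (𝓝[>] (0 : ℝ))

/-! ### Lipschitz conditions -/

/-- `f : 𝒳ⁿ × ℝᵐ → ℝⁿ` is Lipschitz on bounded sets. -/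
def LipOnBounded {Δ : ℝ≥0} {n m : ℕ} (f : Hist Δ n → Vec m → Vec n) : Prop :=
  ∀ r : ℝ, 0 < r → ∃ L : ℝ, 0 < L ∧
    ∀ (φ₁ φ₂ : Hist Δ n) (v₁ v₂ : Vec m),
      ‖φ₁‖ ≤ r → ‖φ₂‖ ≤ r → ‖v₁‖ ≤ r → ‖v₂‖ ≤ r →
        ‖f φ₁ v₁ - f φ₂ v₂‖ ≤ L * (‖φ₁ - φ₂‖ + ‖v₁ - v₂‖)

/-- An input-free vector field `f₀ : 𝒳ⁿ → ℝⁿ` Lipschitz on bounded sets. -/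
def LipOnBounded₀ {Δ : ℝ≥0} {n : ℕ} (f₀ : Hist Δ n → Vec n) : Prop :=
  ∀ r : ℝ, 0 < r → ∃ L : ℝ, 0 < L ∧
    ∀ φ₁ φ₂ : Hist Δ n, ‖φ₁‖ ≤ r → ‖φ₂‖ ≤ r → ‖f₀ φ₁ - f₀ φ₂‖ ≤ L * ‖φ₁ - φ₂‖

/-- A functional `V : 𝒳ⁿ → ℝ` Lipschitz on bounded sets. -/
def LipOnBoundedV {Δ : ℝ≥0} {n : ℕ} (V : Hist Δ n → ℝ) : Prop :=
  ∀ r : ℝ, 0 < r → ∃ L : ℝ, 0 < L ∧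
    ∀ φ₁ φ₂ : Hist Δ n, ‖φ₁‖ ≤ r → ‖φ₂‖ ≤ r → |V φ₁ - V φ₂| ≤ L * ‖φ₁ - φ₂‖

/-- A functional `V : 𝒳ⁿ → ℝ` locally Lipschitz. -/
def LocallyLipV {Δ : ℝ≥0} {n : ℕ} (V : Hist Δ n → ℝ) : Prop :=
  ∀ φ : Hist Δ n, ∃ δ : ℝ, 0 < δ ∧ ∃ L : ℝ, 0 < L ∧
    ∀ φ₁ φ₂ : Hist Δ n, ‖φ₁ - φ‖ ≤ δ → ‖φ₂ - φ‖ ≤ δ → |V φ₁ - V φ₂| ≤ L * ‖φ₁ - φ₂‖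

/-! ### Solutions -/

/-- `x` is a solution of `ẋ(t) = f(x_t, u(t))` with initial state `x₀` on `[0, tmax)`. -/
structure IsSolution (Δ : ℝ≥0) {n m : ℕ} (f : Hist Δ n → Vec m → Vec n)
    (u : ℝ → Vec m) (x₀ : Hist Δ n) (tmax : EReal) (x : ℝ → Vec n) : Prop where
  tmax_pos : 0 < tmax
  cont : ContinuousOn x {s : ℝ | -(Δ : ℝ) ≤ s ∧ (s : EReal) < tmax}
  init : ∀ τ : Icc (-(Δ : ℝ)) (0 : ℝ), x τ.1 = x₀ τ
  integrable : ∀ t : ℝ, 0 ≤ t → (t : EReal) < tmax →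
    IntervalIntegrable (fun s => f (seg Δ x s) (u s)) volume 0 t
  integral_eq : ∀ t : ℝ, 0 ≤ t → (t : EReal) < tmax →
    x t = x 0 + ∫ s in (0:ℝ)..t, f (seg Δ x s) (u s)

/-- Maximal solution: a solution admitting no proper extension. -/
def IsMaxSolution (Δ : ℝ≥0) {n m : ℕ} (f : Hist Δ n → Vec m → Vec n)
    (u : ℝ → Vec m) (x₀ : Hist Δ n) (tmax : EReal) (x : ℝ → Vec n) : Prop :=
  IsSolution Δ f u x₀ tmax x ∧
    ∀ (tmax' : EReal) (x' : ℝ → Vec n), IsSolution Δ f u x₀ tmax' x' →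
      (∀ t : ℝ, -(Δ : ℝ) ≤ t → (t : EReal) < tmax → x' t = x t) → tmax' ≤ tmax

/-- Solution of the input-free system `ẋ(t) = f₀(x_t)`. -/
def IsSolution₀ (Δ : ℝ≥0) {n : ℕ} (f₀ : Hist Δ n → Vec n) (x₀ : Hist Δ n)
    (tmax : EReal) (x : ℝ → Vec n) : Prop :=
  IsSolution Δ (fun φ (_ : Vec 0) => f₀ φ) (fun _ => 0) x₀ tmax x

/-- Maximal solution of the input-free system `ẋ(t) = f₀(x_t)`. -/
def IsMaxSolution₀ (Δ : ℝ≥0) {n : ℕ} (f₀ : Hist Δ n → Vec n) (x₀ : Hist Δ n)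
    (tmax : EReal) (x : ℝ → Vec n) : Prop :=
  IsMaxSolution Δ (fun φ (_ : Vec 0) => f₀ φ) (fun _ => 0) x₀ tmax x

/-! ### Stability properties (input-free systems) -/

/-- Global asymptotic stability (GAS). -/
def GAS (Δ : ℝ≥0) {n : ℕ} (f₀ : Hist Δ n → Vec n) : Prop :=
  ∃ β : ℝ → ℝ → ℝ, ClassKL β ∧
    ∀ (x₀ : Hist Δ n) (tmax : EReal) (x : ℝ → Vec n),
      IsMaxSolution₀ Δ f₀ x₀ tmax x →
        tmax = ⊤ ∧ ∀ t : ℝ, 0 ≤ t → ‖x t‖ ≤ β ‖x₀‖ t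

/-- Global exponential stability (GES). -/
def GES (Δ : ℝ≥0) {n : ℕ} (f₀ : Hist Δ n → Vec n) : Prop :=
  ∃ k : ℝ, 1 ≤ k ∧ ∃ lam : ℝ, 0 < lam ∧
    ∀ (x₀ : Hist Δ n) (tmax : EReal) (x : ℝ → Vec n),
      IsMaxSolution₀ Δ f₀ x₀ tmax x →
        tmax = ⊤ ∧ ∀ t : ℝ, 0 ≤ t → ‖x t‖ ≤ k * ‖x₀‖ * Real.exp (-lam * t)

/-- (Local) asymptotic stability (AS) of the origin. -/
def AS (Δ : ℝ≥0) {n : ℕ} (f₀ : Hist Δ n → Vec n) : Prop :=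
  ∃ r : ℝ, 0 < r ∧ ∃ β : ℝ → ℝ → ℝ, ClassKL β ∧
    ∀ (x₀ : Hist Δ n) (tmax : EReal) (x : ℝ → Vec n),
      IsMaxSolution₀ Δ f₀ x₀ tmax x → ‖x₀‖ ≤ r →
        tmax = ⊤ ∧ ∀ t : ℝ, 0 ≤ t → ‖x t‖ ≤ β ‖x₀‖ t

/-- (Local) exponential stability (ES) of the origin. -/
def ES (Δ : ℝ≥0) {n : ℕ} (f₀ : Hist Δ n → Vec n) : Prop :=
  ∃ r : ℝ, 0 < r ∧ ∃ k : ℝ, 1 ≤ k ∧ ∃ lam : ℝ, 0 < lam ∧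
    ∀ (x₀ : Hist Δ n) (tmax : EReal) (x : ℝ → Vec n),
      IsMaxSolution₀ Δ f₀ x₀ tmax x → ‖x₀‖ ≤ r →
        tmax = ⊤ ∧ ∀ t : ℝ, 0 ≤ t → ‖x t‖ ≤ k * ‖x₀‖ * Real.exp (-lam * t)

/-! ### Forward completeness -/

/-- Robust forward completeness (RFC) of `ẋ(t) = f(x_t,u(t))`. -/
def RFC (Δ : ℝ≥0) {n m : ℕ} (f : Hist Δ n → Vec m → Vec n) : Prop :=
  (∀ (x₀ : Hist Δ n) (u : ℝ → Vec m) (tmax : EReal) (x : ℝ → Vec n),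
      IsInput u → IsMaxSolution Δ f u x₀ tmax x → tmax = ⊤) ∧
    ∀ T : ℝ, 0 < T → ∀ r : ℝ, 0 < r → ∃ C : ℝ,
      ∀ (x₀ : Hist Δ n) (u : ℝ → Vec m) (tmax : EReal) (x : ℝ → Vec n),
        IsInput u → IsMaxSolution Δ f u x₀ tmax x →
          ‖x₀‖ ≤ r → essBnd u (Ici 0) ≤ r →
            ∀ t : ℝ, t ∈ Icc (0 : ℝ) T → ‖seg Δ x t‖ ≤ C

/-- Robust forward completeness of the input-free system `ẋ(t) = f₀(x_t)`. -/
def RFC₀ (Δ : ℝ≥0) {n : ℕ} (f₀ : Hist Δ n → Vec n) : Prop :=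
  RFC Δ (fun φ (_ : Vec 0) => f₀ φ)

/-! ### Input-to-state stability notions -/

/-- Input-to-state stability (ISS). -/
def ISS (Δ : ℝ≥0) {n m : ℕ} (f : Hist Δ n → Vec m → Vec n) : Prop :=
  ∃ β : ℝ → ℝ → ℝ, ∃ μ : ℝ → ℝ, ClassKL β ∧ ClassN μ ∧
    ∀ (x₀ : Hist Δ n) (u : ℝ → Vec m) (tmax : EReal) (x : ℝ → Vec n),
      IsInput u → IsMaxSolution Δ f u x₀ tmax x →
        tmax = ⊤ ∧ ∀ t : ℝ, 0 ≤ t → ‖x t‖ ≤ β ‖x₀‖ t + μ (essBnd u (Icc 0 t))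

/-- Local input-to-state stability (LISS). -/
def LISS (Δ : ℝ≥0) {n m : ℕ} (f : Hist Δ n → Vec m → Vec n) : Prop :=
  ∃ r : ℝ, 0 < r ∧ ∃ β : ℝ → ℝ → ℝ, ∃ μ : ℝ → ℝ, ClassKL β ∧ ClassN μ ∧
    ∀ (x₀ : Hist Δ n) (u : ℝ → Vec m) (tmax : EReal) (x : ℝ → Vec n),
      IsInput u → IsMaxSolution Δ f u x₀ tmax x →
        ‖x₀‖ ≤ r → essBnd u (Ici 0) ≤ r →
          tmax = ⊤ ∧ ∀ t : ℝ, 0 ≤ t → ‖x t‖ ≤ β ‖x₀‖ t + μ (essBnd u (Icc 0 t))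

/-- Integral input-to-state stability (iISS). -/
def iISS (Δ : ℝ≥0) {n m : ℕ} (f : Hist Δ n → Vec m → Vec n) : Prop :=
  ∃ β : ℝ → ℝ → ℝ, ∃ η μ : ℝ → ℝ, ClassKL β ∧ ClassN η ∧ ClassN μ ∧
    ∀ (x₀ : Hist Δ n) (u : ℝ → Vec m) (tmax : EReal) (x : ℝ → Vec n),
      IsInput u → IsMaxSolution Δ f u x₀ tmax x →
        tmax = ⊤ ∧ ∀ t : ℝ, 0 ≤ t →
          ‖x t‖ ≤ β ‖x₀‖ t + η (∫ s in (0:ℝ)..t, μ ‖u s‖)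

/-- The UBEBS estimate with offset `c`. -/
def UBEBSwith (Δ : ℝ≥0) {n m : ℕ} (f : Hist Δ n → Vec m → Vec n) (c : ℝ) : Prop :=
  ∃ α ξ ζ : ℝ → ℝ, ClassKinf α ∧ ClassKinf ξ ∧ ClassKinf ζ ∧
    ∀ (x₀ : Hist Δ n) (u : ℝ → Vec m) (tmax : EReal) (x : ℝ → Vec n),
      IsInput u → IsMaxSolution Δ f u x₀ tmax x →
        tmax = ⊤ ∧ ∀ t : ℝ, 0 ≤ t →
          α ‖x t‖ ≤ ξ ‖x₀‖ + (∫ s in (0:ℝ)..t, ζ ‖u s‖) + c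

/-! ### Lyapunov–Krasovskii functionals -/

/-- Lyapunov–Krasovskii functional candidate (LKF). -/
def IsLKF {Δ : ℝ≥0} {n : ℕ} (V : Hist Δ n → ℝ) : Prop :=
  (∀ φ, 0 ≤ V φ) ∧ LipOnBoundedV V ∧
    ∃ α₁ α₂ : ℝ → ℝ, ClassKinf α₁ ∧ ClassKinf α₂ ∧
      ∀ φ : Hist Δ n, α₁ ‖ev0 φ‖ ≤ V φ ∧ V φ ≤ α₂ ‖φ‖

/-- Coercive Lyapunov–Krasovskii functional candidate. -/
def IsCoerciveLKF {Δ : ℝ≥0} {n : ℕ} (V : Hist Δ n → ℝ) : Prop :=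
  (∀ φ, 0 ≤ V φ) ∧ LipOnBoundedV V ∧
    ∃ α₁ α₂ : ℝ → ℝ, ClassKinf α₁ ∧ ClassKinf α₂ ∧
      ∀ φ : Hist Δ n, α₁ ‖φ‖ ≤ V φ ∧ V φ ≤ α₂ ‖φ‖

end

/-- The continuous curve of history segments of a continuous function on `ℝ`. -/
def histCurve (Δ : ℝ≥0) {n : ℕ} (y : C(ℝ, Vec n)) : C(ℝ, Hist Δ n) :=
  ContinuousMap.curry
    ⟨fun p : ℝ × Icc (-(Δ : ℝ)) (0 : ℝ) => y (p.1 + p.2.1), by fun_prop⟩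

theorem histCurve_apply {Δ : ℝ≥0} {n : ℕ} (y : C(ℝ, Vec n)) (t : ℝ)
    (τ : Icc (-(Δ : ℝ)) (0 : ℝ)) : histCurve Δ y t τ = y (t + τ.1) := rfl

theorem seg_eq_histCurve {Δ : ℝ≥0} {n : ℕ} {x : ℝ → Vec n} {y : C(ℝ, Vec n)} {t : ℝ}
    (h : EqOn x y (Icc (t - (Δ : ℝ)) t)) : seg Δ x t = histCurve Δ y t := by
  have hx : ContinuousOn x (Icc (t - (Δ : ℝ)) t) := y.continuous.continuousOn.congr h
  rw [seg, dif_pos hx]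
  ext1 τ
  exact h ⟨by linarith [τ.2.1], by linarith [τ.2.2]⟩

theorem LipOnBounded₀.continuous {Δ : ℝ≥0} {n : ℕ} {f₀ : Hist Δ n → Vec n}
    (hf : LipOnBounded₀ f₀) : Continuous f₀ := by
  refine continuous_iff_continuousAt.2 fun φ => ?_
  obtain ⟨L, -, hL⟩ := hf (‖φ‖ + 1) (by positivity)
  rw [ContinuousAt, tendsto_iff_norm_sub_tendsto_zero]
  have hlim : Tendsto (fun ψ : Hist Δ n => L * ‖ψ - φ‖) (𝓝 φ) (𝓝 0) := by
    have : Continuous fun ψ : Hist Δ n => L * ‖ψ - φ‖ := by fun_prop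
    simpa using this.tendsto φ
  refine squeeze_zero' (Eventually.of_forall fun _ => norm_nonneg _) ?_ hlim
  filter_upwards [Metric.ball_mem_nhds φ one_pos] with ψ hψ
  rw [mem_ball_iff_norm] at hψ
  refine hL _ _ ?_ (by linarith)
  linarith [norm_le_norm_add_norm_sub' ψ φ]

/-- A vector field that is Lipschitz on bounded sets is bounded on bounded sets. -/
theorem LipOnBounded₀.exists_bound {Δ : ℝ≥0} {n : ℕ} {f₀ : Hist Δ n → Vec n}
    (hf : LipOnBounded₀ f₀) {r : ℝ} (hr : 0 < r) :
    ∃ C : ℝ, 0 < C ∧ ∀ φ : Hist Δ n, ‖φ‖ ≤ r → ‖f₀ φ‖ ≤ C := by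
  obtain ⟨L, hL0, hL⟩ := hf r hr
  refine ⟨‖f₀ 0‖ + L * r, by positivity, fun φ hφ => ?_⟩
  have h1 := hL φ 0 hφ (by simpa using hr.le)
  rw [sub_zero] at h1
  have h2 : L * ‖φ‖ ≤ L * r := by gcongr
  linarith [norm_le_norm_add_norm_sub' (f₀ φ) (f₀ 0)]

/-- Local existence for the retarded equation `ẋ(t) = f₀(x_t)` by Picard iteration. -/
theorem exists_local_solution {Δ : ℝ≥0} {n : ℕ} {f₀ : Hist Δ n → Vec n}
    (hf : LipOnBounded₀ f₀) (φ : Hist Δ n) :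
    ∃ δ : ℝ, 0 < δ ∧ ∃ y : C(ℝ, Vec n), (∀ τ : Icc (-(Δ : ℝ)) (0 : ℝ), y τ.1 = φ τ) ∧
      ∀ t ∈ Icc 0 δ, y t = ev0 φ + ∫ s in (0 : ℝ)..t, f₀ (histCurve Δ y s) := by
  have hr : 0 < ‖φ‖ + 1 := by positivity
  obtain ⟨L, hL0, hL⟩ := hf _ hr
  obtain ⟨C, hC0, hC⟩ := hf.exists_bound hr
  obtain ⟨δ, hδ, hLδ, hCδ⟩ : ∃ δ : ℝ, 0 < δ ∧ L * δ ≤ 1 / 2 ∧ C * δ ≤ 1 := by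
    refine ⟨1 / (2 * (L + C)), by positivity, ?_, ?_⟩
    · rw [mul_one_div, div_le_div_iff₀ (by positivity) two_pos]; linarith
    · rw [mul_one_div, div_le_one (by positivity)]; linarith
  have hD : -(Δ : ℝ) ≤ 0 := neg_nonpos.2 Δ.coe_nonneg
  let E : C(Icc 0 δ, Vec n) → C(ℝ, Vec n) := fun z =>
    ⟨fun t => φ (projIcc (-(Δ : ℝ)) 0 hD t) + z (projIcc 0 δ hδ.le t),
      (φ.continuous.comp continuous_projIcc).add (z.continuous.comp continuous_projIcc)⟩
  have hE : ∀ z t, E z t = φ (projIcc (-(Δ : ℝ)) 0 hD t) + z (projIcc 0 δ hδ.le t) :=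
    fun _ _ => rfl
  have hcont : ∀ z, Continuous fun s => f₀ (histCurve Δ (E z) s) := fun z =>
    hf.continuous.comp (histCurve Δ (E z)).continuous
  let F : C(Icc 0 δ, Vec n) → C(Icc 0 δ, Vec n) := fun z =>
    ⟨fun t => ∫ s in (0 : ℝ)..t.1, f₀ (histCurve Δ (E z) s),
      (intervalIntegral.continuous_primitive
        (fun a b => (hcont z).intervalIntegrable a b) 0).comp continuous_subtype_val⟩
  have hF : ∀ z t, F z t = ∫ s in (0 : ℝ)..t.1, f₀ (histCurve Δ (E z) s) := fun _ _ => rfl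
  have hEnorm : ∀ z ∈ Metric.closedBall (0 : C(Icc 0 δ, Vec n)) 1, ∀ s,
      ‖histCurve Δ (E z) s‖ ≤ ‖φ‖ + 1 := by
    intro z hz s
    rw [mem_closedBall_zero_iff] at hz
    refine (ContinuousMap.norm_le _ hr.le).2 fun τ => ?_
    rw [histCurve_apply, hE]
    exact (norm_add_le _ _).trans
      (add_le_add (φ.norm_coe_le_norm _) ((z.norm_coe_le_norm _).trans hz))
  have hEsub : ∀ z z' s, ‖histCurve Δ (E z) s - histCurve Δ (E z') s‖ ≤ ‖z - z'‖ := by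
    intro z z' s
    refine (ContinuousMap.norm_le _ (norm_nonneg _)).2 fun τ => ?_
    rw [ContinuousMap.sub_apply, histCurve_apply, histCurve_apply, hE, hE, add_sub_add_left_eq_sub]
    exact (z - z').norm_coe_le_norm _
  have hmaps : MapsTo F (Metric.closedBall 0 1) (Metric.closedBall 0 1) := by
    intro z hz
    rw [mem_closedBall_zero_iff]
    refine (ContinuousMap.norm_le _ zero_le_one).2 fun t => ?_
    rw [hF]
    refine (intervalIntegral.norm_integral_le_of_norm_le_const
      fun s _ => hC _ (hEnorm z hz s)).trans ?_
    rw [sub_zero, abs_of_nonneg t.2.1]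
    exact (mul_le_mul_of_nonneg_left t.2.2 hC0.le).trans hCδ
  have hlip : ContractingWith (1 / 2 : ℝ≥0) (hmaps.restrict F _ _) := by
    refine ⟨by rw [← NNReal.coe_lt_coe]; norm_num, LipschitzWith.of_dist_le_mul ?_⟩
    rintro ⟨z, hz⟩ ⟨z', hz'⟩
    rw [Subtype.dist_eq, Subtype.dist_eq, dist_eq_norm, dist_eq_norm]
    refine (ContinuousMap.norm_le _ (by positivity)).2 fun t => ?_
    change ‖F z t - F z' t‖ ≤ _
    rw [hF, hF, ← intervalIntegral.integral_sub ((hcont z).intervalIntegrable _ _)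
      ((hcont z').intervalIntegrable _ _)]
    have hbd : ∀ s ∈ uIoc 0 t.1,
        ‖f₀ (histCurve Δ (E z) s) - f₀ (histCurve Δ (E z') s)‖ ≤ L * ‖z - z'‖ := fun s _ =>
      (hL _ _ (hEnorm z hz s) (hEnorm z' hz' s)).trans
        (mul_le_mul_of_nonneg_left (hEsub z z' s) hL0.le)
    refine (intervalIntegral.norm_integral_le_of_norm_le_const hbd).trans ?_
    rw [sub_zero, abs_of_nonneg t.2.1]
    calc L * ‖z - z'‖ * t.1 ≤ L * ‖z - z'‖ * δ := by
          have := t.2.2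
          gcongr
      _ = L * δ * ‖z - z'‖ := by ring
      _ ≤ 1 / 2 * ‖z - z'‖ := by gcongr
      _ = _ := by norm_num
  obtain ⟨z, -, hz, -⟩ := hlip.exists_fixedPoint' Metric.isClosed_closedBall.isComplete hmaps
    (Metric.mem_closedBall_self zero_le_one) (edist_ne_top _ _)
  have hzt : ∀ t, z t = ∫ s in (0 : ℝ)..t.1, f₀ (histCurve Δ (E z) s) := fun t => by
    rw [← hF, hz]
  refine ⟨δ, hδ, E z, fun τ => ?_, fun t ht => ?_⟩
  · rw [hE, projIcc_val, projIcc_of_le_left hδ.le τ.2.2, hzt, intervalIntegral.integral_same,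
      add_zero]
  · rw [hE, projIcc_of_right_le hD ht.1, projIcc_of_mem hδ.le ht, hzt]
    rfl

/-- A barrier principle for delay differential inequalities: a function starting below a
nonincreasing `κ`-Lipschitz barrier, whose right derivative is less than `-κ` whenever it touches
the barrier for the first time, remains below it. -/
theorem le_barrier_of_delay_inequality {Δ : ℝ≥0} {α γ w w' p : ℝ → ℝ} {b κ : ℝ}
    (hw : ContinuousOn w (Icc 0 b))
    (hw' : ∀ t ∈ Ico 0 b, HasDerivWithinAt w (w' t) (Ici t) t)
    (hineq : ∀ t ∈ Ico 0 b, ∀ m, (∀ s ∈ Icc (t - (Δ : ℝ)) t, w s ≤ m) →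
      w' t ≤ -α (w t) + γ m)
    (hκ : 0 ≤ κ) (hp : Continuous p) (hslope : ∀ s t, s ≤ t → p s ≤ p t + κ * (t - s))
    (hinit : ∀ s ∈ Icc (-(Δ : ℝ)) 0, w s ≤ p s)
    (hneg : ∀ t, 0 ≤ t → γ (p t + κ * Δ) + κ < α (p t)) :
    ∀ t ∈ Icc 0 b, w t ≤ p t := by
  by_contra! hcon
  obtain ⟨t₁, ht₁, hlt₁⟩ := hcon
  set B : Set ℝ := {t | t ∈ Icc 0 b ∧ p t < w t}
  have hBne : B.Nonempty := ⟨t₁, ht₁, hlt₁⟩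
  have hBbdd : BddBelow B := ⟨0, fun t ht => ht.1.1⟩
  set c := sInf B
  have hc0 : 0 ≤ c := le_csInf hBne fun t ht => ht.1.1
  have hct₁ : c ≤ t₁ := csInf_le hBbdd ⟨ht₁, hlt₁⟩
  have hcb : c ∈ Icc 0 b := ⟨hc0, hct₁.trans ht₁.2⟩
  have hbelow : ∀ s ∈ Ico (-(Δ : ℝ)) c, w s ≤ p s := by
    intro s hs
    rcases le_total s 0 with h0 | h0
    · exact hinit s ⟨hs.1, h0⟩
    · by_contra! h
      exact (csInf_le hBbdd ⟨⟨h0, hs.2.le.trans hcb.2⟩, h⟩).not_gt hs.2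
  have hwc : w c ≤ p c := by
    rcases hc0.eq_or_lt with h0 | h0
    · exact hinit c ⟨by rw [← h0]; exact neg_nonpos.2 Δ.coe_nonneg, h0.ge⟩
    · have hcl : c ∈ closure (Ico 0 c) := by
        rw [closure_Ico h0.ne]; exact right_mem_Icc.2 hc0
      have hsub : Ico 0 c ⊆ Icc 0 b := fun s hs => ⟨hs.1, hs.2.le.trans hcb.2⟩
      exact ContinuousWithinAt.closure_le hcl ((hw c hcb).mono hsub)
        hp.continuousWithinAt fun s hs =>
          hbelow s ⟨(neg_nonpos.2 Δ.coe_nonneg).trans hs.1, hs.2⟩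
  have hclt : c < b :=
    (hct₁.lt_of_ne fun h => hlt₁.not_ge (h ▸ hwc)).trans_le ht₁.2
  have hcI : c ∈ Ico 0 b := ⟨hc0, hclt⟩
  have hright : ∀ᶠ t in 𝓝[>] c, w t ≤ p t := by
    rcases hwc.lt_or_eq with hlt | heq
    · have h1 : ContinuousWithinAt w (Ioi c) c :=
        (hw' c hcI).continuousWithinAt.mono Ioi_subset_Ici_self
      exact (h1.eventually_lt hp.continuousWithinAt hlt).mono fun _ h => h.le
    · have hder : w' c < -κ := by
        have h1 := hineq c hcI (p c + κ * Δ) fun s hs => by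
          rcases hs.2.lt_or_eq with hsc | hsc
          · refine (hbelow s ⟨by linarith [hs.1], hsc⟩).trans ((hslope s c hs.2).trans ?_)
            have := hs.1
            gcongr
            linarith
          · rw [hsc, heq]
            have : 0 ≤ κ * (Δ : ℝ) := mul_nonneg hκ Δ.coe_nonneg
            linarith
        have h2 := hneg c hc0
        rw [heq] at h1
        linarith
      have hs := ((hw' c hcI).mono Ioi_subset_Ici_self).limsup_slope_le' self_notMem_Ioi hder
      filter_upwards [hs, self_mem_nhdsWithin] with t ht htc
      have hpos : 0 < t - c := sub_pos.2 htc
      rw [slope_def_field, div_lt_iff₀ hpos] at ht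
      linarith [hslope c t (le_of_lt htc)]
  obtain ⟨u, hu, hcu⟩ := mem_nhdsGT_iff_exists_Ioo_subset.1 hright
  obtain ⟨s, hsB, hsu⟩ := exists_lt_of_csInf_lt hBne (show sInf B < u from hu)
  have hcs : c ≤ s := csInf_le hBbdd hsB
  rcases hcs.eq_or_lt with h | h
  · exact hsB.2.not_ge (h ▸ hwc)
  · exact hsB.2.not_ge (hcu ⟨h, hsu⟩)

/-- A quantified version of `γ < α`: the gap leaves room for a continuous rate `g`, even after
shifting the argument of `γ` by the rate times the delay. -/
theorem exists_decay_rate (Δ : ℝ≥0) {α γ : ℝ → ℝ} (hα : ClassP α) (hγ : ClassK γ)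
    (hαγ : ClassP fun s => α s - γ s) :
    ∃ g : ℝ → ℝ, Continuous g ∧ (∀ s, 0 ≤ g s) ∧ g 0 = 0 ∧
      ∀ s, 0 < s → 0 < g s ∧ ∀ κ ∈ Icc 0 (g s), γ (s + κ * Δ) + κ < α s := by
  have hα' : Continuous fun s : ℝ => α (max s 0) :=
    hα.1.comp_continuous (by fun_prop) fun s => le_max_right s 0
  have hγ' : Continuous fun s : ℝ => γ (max s 0) :=
    hγ.1.comp_continuous (by fun_prop) fun s => le_max_right s 0
  let q : ℝ → ℝ → ℝ := fun s h => max h (α (max s 0) - γ (max (s + h * Δ) 0))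
  have hq : Continuous ↿q := by
    refine continuous_snd.max ((hα'.comp continuous_fst).sub (hγ'.comp (?_ : Continuous
      fun x : ℝ × ℝ => x.1 + x.2 * (Δ : ℝ))))
    fun_prop
  let m : ℝ → ℝ := fun s => sInf (q s '' Icc 0 1)
  have hm : Continuous m := isCompact_Icc.continuous_sInf hq
  have hq0 : ∀ s, ∀ h ∈ Icc (0 : ℝ) 1, 0 ≤ q s h := fun s h hh => hh.1.trans (le_max_left _ _)
  have hmle : ∀ s, ∀ h ∈ Icc (0 : ℝ) 1, m s ≤ q s h := fun s h hh =>
    csInf_le ⟨0, by rintro _ ⟨h, hh, rfl⟩; exact hq0 s h hh⟩ (mem_image_of_mem _ hh)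
  have hne : (Icc (0 : ℝ) 1).Nonempty := nonempty_Icc.2 zero_le_one
  have hm0 : ∀ s, 0 ≤ m s := fun s =>
    le_csInf (hne.image _) (by rintro _ ⟨h, hh, rfl⟩; exact hq0 s h hh)
  refine ⟨fun s => min 1 (m s) / 2, by fun_prop, fun s => ?_, ?_, fun s hs => ⟨?_, ?_⟩⟩
  · have := hm0 s
    positivity
  · have h1 : m 0 ≤ 0 := (hmle 0 0 (left_mem_Icc.2 zero_le_one)).trans_eq (by
      simp [q, hα.2.1, hγ.2.2])
    simp [le_antisymm h1 (hm0 0)]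
  · obtain ⟨h, hh, hmin⟩ := isCompact_Icc.exists_sInf_image_eq hne
      (hq.comp (Continuous.prodMk_right s)).continuousOn
    have : 0 < m s := by
      change 0 < sInf (q s '' Icc 0 1)
      have hmin' : sInf (q s '' Icc 0 1) = q s h := hmin
      rw [hmin']
      rcases hh.1.eq_or_lt with h0 | h0
      · refine lt_max_of_lt_right ?_
        rw [← h0, zero_mul, add_zero, max_eq_left hs.le]
        exact hαγ.2.2 s hs
      · exact lt_max_of_lt_left h0
    positivity
  · rintro κ ⟨hκ0, hκ⟩
    set h := min 1 (m s) / 2 with hh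
    have h1 : min 1 (m s) ≤ 1 := min_le_left _ _
    have h2 : min 1 (m s) ≤ m s := min_le_right _ _
    have hΔ : κ * (Δ : ℝ) ≤ h * Δ := by gcongr
    have hκΔ : 0 ≤ κ * (Δ : ℝ) := by positivity
    have hγle : γ (s + κ * Δ) ≤ γ (s + h * Δ) :=
      hγ.2.1.monotoneOn (mem_Ici.2 (by linarith)) (mem_Ici.2 (by linarith)) (by linarith)
    have hqle := hmle s h ⟨by linarith, by linarith⟩
    rcases le_max_iff.1 hqle with h3 | h3
    · have hκz : κ = 0 := by linarith
      simpa [hκz] using hαγ.2.2 s hs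
    · rw [max_eq_left hs.le, max_eq_left (by linarith)] at h3
      rcases hκ0.eq_or_lt with h4 | h4
      · simpa [← h4] using hαγ.2.2 s hs
      · linarith

/-- A nonlinear Halanay inequality: solutions of the delay inequality decay linearly with any
admissible rate `κ` until they reach the level `ε`. -/
theorem halanay_linear_decay {Δ : ℝ≥0} {α γ w w' g : ℝ → ℝ} {b M ε κ : ℝ}
    (hg : ∀ s, 0 < s → 0 < g s ∧ ∀ κ ∈ Icc 0 (g s), γ (s + κ * Δ) + κ < α s)
    (hw : ContinuousOn w (Icc 0 b))
    (hw' : ∀ t ∈ Ico 0 b, HasDerivWithinAt w (w' t) (Ici t) t)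
    (hineq : ∀ t ∈ Ico 0 b, ∀ m, (∀ s ∈ Icc (t - (Δ : ℝ)) t, w s ≤ m) →
      w' t ≤ -α (w t) + γ m)
    (hinit : ∀ s ∈ Icc (-(Δ : ℝ)) 0, w s ≤ M)
    (hε : 0 < ε) (hκ : 0 ≤ κ) (hκg : ∀ s ∈ Icc ε (max ε M), κ ≤ g s) :
    ∀ t ∈ Icc 0 b, w t ≤ max ε (M - κ * t) := by
  refine le_barrier_of_delay_inequality hw hw' hineq hκ (by fun_prop) ?_ ?_ ?_
  · intro s t hst
    have : 0 ≤ κ * (t - s) := mul_nonneg hκ (sub_nonneg.2 hst)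
    refine max_le ?_ ?_
    · linarith [le_max_left ε (M - κ * t)]
    · linarith [le_max_right ε (M - κ * t)]
  · intro s hs
    refine (hinit s hs).trans (le_max_of_le_right ?_)
    nlinarith [mul_nonneg hκ (neg_nonneg.2 hs.2)]
  · intro t ht
    have h1 : ε ≤ max ε (M - κ * t) := le_max_left _ _
    refine (hg _ (hε.trans_le h1)).2 κ ⟨hκ, hκg _ ⟨h1, max_le_max le_rfl ?_⟩⟩
    linarith [mul_nonneg hκ ht]

/-- Linear decay up to every positive level, at rates bounded below by a continuous function of the
state, is majorized by a `𝒦ℒ`-like function. -/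
theorem exists_decay_majorant {g : ℝ → ℝ} (hg : Continuous g) (hg0 : ∀ s, 0 ≤ g s)
    (hgz : g 0 = 0) (hgpos : ∀ s, 0 < s → 0 < g s) :
    ∃ ψ : ℝ → ℝ → ℝ, (∀ t, Continuous fun M => ψ M t) ∧ (∀ M, Continuous (ψ M)) ∧
      (∀ t, ψ 0 t = 0) ∧ (∀ M t, 0 ≤ M → 0 ≤ ψ M t) ∧
      (∀ t, 0 ≤ t → MonotoneOn (fun M => ψ M t) (Ici 0)) ∧
      (∀ M, 0 ≤ M → Antitone (ψ M)) ∧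
      (∀ M, 0 ≤ M → Tendsto (ψ M) atTop (𝓝 0)) ∧
      ∀ M t y, 0 ≤ M → 0 ≤ t → y ≤ M →
        (∀ ε κ, 0 < ε → ε ≤ M → 0 ≤ κ → (∀ s ∈ Icc ε M, κ ≤ g s) → y ≤ max ε (M - κ * t)) →
        y ≤ ψ M t := by
  have hI : IsCompact (Icc (0 : ℝ) 1) := isCompact_Icc
  have hne : (Icc (0 : ℝ) 1).Nonempty := nonempty_Icc.2 zero_le_one
  let k : ℝ × ℝ → ℝ → ℝ := fun a v => g (a.1 + v * (a.2 - a.1))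
  have hk : Continuous ↿k := by
    refine hg.comp (?_ : Continuous fun x : (ℝ × ℝ) × ℝ => x.1.1 + x.2 * (x.1.2 - x.1.1))
    fun_prop
  let K : ℝ × ℝ → ℝ := fun a => sInf (k a '' Icc 0 1)
  have hK : Continuous K := hI.continuous_sInf hk
  have hK0 : ∀ a, 0 ≤ K a := fun a =>
    le_csInf (hne.image _) (by rintro _ ⟨v, -, rfl⟩; exact hg0 _)
  have hKle : ∀ ε M s, s ∈ Icc ε M → K (ε, M) ≤ g s := by
    intro ε M s hs
    have hseg : s ∈ (fun v => ε + v * (M - ε)) '' Icc 0 1 := by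
      rw [← segment_eq_Icc (hs.1.trans hs.2), segment_eq_image'] at hs
      simpa using hs
    obtain ⟨v, hv, rfl⟩ := hseg
    exact csInf_le ⟨0, by rintro _ ⟨v, -, rfl⟩; exact hg0 _⟩ ⟨v, hv, rfl⟩
  have hleK : ∀ ε M c, ε ≤ M → (∀ s ∈ Icc ε M, c ≤ g s) → c ≤ K (ε, M) := by
    intro ε M c hεM h
    refine le_csInf (hne.image _) ?_
    rintro _ ⟨v, hv, rfl⟩
    refine h _ ⟨?_, ?_⟩
    · nlinarith [mul_nonneg hv.1 (sub_nonneg.2 hεM)]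
    · nlinarith [mul_le_mul_of_nonneg_right hv.2 (sub_nonneg.2 hεM)]
  let Q : ℝ × ℝ → ℝ → ℝ := fun a u => max (u * a.1) (a.1 - K (u * a.1, a.1) * a.2)
  have hQ : Continuous ↿Q := by
    refine Continuous.max (f := fun x : (ℝ × ℝ) × ℝ => x.2 * x.1.1)
      (g := fun x : (ℝ × ℝ) × ℝ => x.1.1 - K (x.2 * x.1.1, x.1.1) * x.1.2) (by fun_prop) ?_
    fun_prop
  have hψ : Continuous fun a => sInf (Q a '' Icc 0 1) := hI.continuous_sInf hQ
  let ψ : ℝ → ℝ → ℝ := fun M t => sInf (Q (M, t) '' Icc 0 1)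
  have hQ0 : ∀ M t, 0 ≤ M → ∀ u ∈ Icc (0 : ℝ) 1, 0 ≤ Q (M, t) u := fun M t hM u hu =>
    le_max_of_le_left (mul_nonneg hu.1 hM)
  have hle : ∀ M t u, 0 ≤ M → u ∈ Icc (0 : ℝ) 1 → ψ M t ≤ Q (M, t) u := fun M t u hM hu =>
    csInf_le ⟨0, by rintro _ ⟨v, hv, rfl⟩; exact hQ0 M t hM v hv⟩ (mem_image_of_mem _ hu)
  have hge : ∀ M t c, (∀ u ∈ Icc (0 : ℝ) 1, c ≤ Q (M, t) u) → c ≤ ψ M t := fun M t c h =>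
    le_csInf (hne.image _) (by rintro _ ⟨v, hv, rfl⟩; exact h v hv)
  have hψle : ∀ M t ε, 0 ≤ ε → ε ≤ M → ψ M t ≤ max ε (M - K (ε, M) * t) := by
    intro M t ε hε hεM
    rcases (hε.trans hεM).eq_or_lt with hM | hM
    · have := hle M t 0 hM.le (left_mem_Icc.2 zero_le_one)
      have hz : ε = 0 := by linarith
      simpa [Q, hz, ← hM] using this
    · have := hle M t (ε / M) hM.le ⟨by positivity, (div_le_one hM).2 hεM⟩
      simpa [Q, div_mul_cancel₀ _ hM.ne'] using this
  have hψ0 : ∀ M t, 0 ≤ M → 0 ≤ ψ M t := fun M t hM => hge M t 0 (hQ0 M t hM)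
  have hψz : ∀ t, ψ 0 t = 0 := fun t => by
    refine le_antisymm ((hψle 0 t 0 le_rfl le_rfl).trans ?_) (hψ0 0 t le_rfl)
    have : K (0, 0) = 0 :=
      le_antisymm ((hKle 0 0 0 (left_mem_Icc.2 le_rfl)).trans_eq hgz) (hK0 _)
    simp [this]
  refine ⟨ψ, fun t => hψ.comp (by fun_prop : Continuous fun M : ℝ => (M, t)),
    fun M => hψ.comp (by fun_prop : Continuous fun t : ℝ => (M, t)), hψz, hψ0, ?_, ?_, ?_, ?_⟩
  · intro t ht M₁ hM₁ M₂ hM₂ h12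
    refine hge _ _ _ fun u hu => ?_
    have hu0 : 0 ≤ u * M₂ := mul_nonneg hu.1 hM₂
    have hu1 : u * M₂ ≤ M₂ := mul_le_of_le_one_left hM₂ hu.2
    rcases le_total (u * M₂) M₁ with h | h
    · refine (hψle M₁ t _ hu0 h).trans (max_le_max le_rfl ?_)
      have : K (u * M₂, M₂) ≤ K (u * M₂, M₁) :=
        hleK _ _ _ h fun s hs => hKle _ _ _ ⟨hs.1, hs.2.trans h12⟩
      have := mul_le_mul_of_nonneg_right this ht
      change M₁ - K (u * M₂, M₁) * t ≤ M₂ - K (u * M₂, M₂) * t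
      linarith
    · refine (hψle M₁ t M₁ hM₁ le_rfl).trans ?_
      refine (max_le le_rfl ?_).trans (h.trans (le_max_left _ _))
      linarith [mul_nonneg (hK0 (M₁, M₁)) ht]
  · intro M hM t₁ t₂ h12
    refine hge _ _ _ fun u hu => (hle M t₂ u hM hu).trans (max_le_max le_rfl ?_)
    have := mul_le_mul_of_nonneg_left h12 (hK0 (u * M, M))
    change M - K (u * M, M) * t₂ ≤ M - K (u * M, M) * t₁
    linarith
  · intro M hM
    rcases hM.eq_or_lt with h0 | h0
    · rw [← h0, funext hψz]; exact tendsto_const_nhds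
    refine (tendsto_order.2 ⟨fun a ha => Eventually.of_forall fun t => ha.trans_le (hψ0 M t hM),
      fun η hη => ?_⟩)
    have hε : 0 < min M (η / 2) := by positivity
    have hεM : min M (η / 2) ≤ M := min_le_left _ _
    obtain ⟨s, hs, hmin⟩ := isCompact_Icc.exists_isMinOn (nonempty_Icc.2 hεM) hg.continuousOn
    have hc : 0 < K (min M (η / 2), M) :=
      (hgpos s (hε.trans_le hs.1)).trans_le (hleK _ _ _ hεM fun r hr => hmin hr)
    filter_upwards [eventually_ge_atTop (M / K (min M (η / 2), M))] with t ht
    refine (hψle M t _ hε.le hεM).trans_lt (max_lt ?_ ?_)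
    · linarith [min_le_right M (η / 2)]
    · rw [div_le_iff₀ hc] at ht
      linarith
  · intro M t y hM ht hyM hy
    refine hge _ _ _ fun u hu => ?_
    have hu0 : 0 ≤ u * M := mul_nonneg hu.1 hM
    have hu1 : u * M ≤ M := mul_le_of_le_one_left hM hu.2
    rcases hu0.eq_or_lt with h | h
    · refine le_max_of_le_right ?_
      have hKz : K (u * M, M) = 0 :=
        le_antisymm ((hKle _ _ _ (left_mem_Icc.2 hu1)).trans_eq (by rw [← h, hgz])) (hK0 _)
      change y ≤ M - K (u * M, M) * t
      rw [hKz]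
      linarith
    · exact hy _ _ h hu1 (hK0 _) fun s hs => hKle _ _ _ hs

/-- Class `𝒦∞` functions have continuous strictly increasing left inverses. -/
theorem ClassKinf.exists_inverse {α : ℝ → ℝ} (hα : ClassKinf α) :
    ∃ a : ℝ → ℝ, Continuous a ∧ StrictMono a ∧ a 0 = 0 ∧ ∀ r, 0 ≤ r → a (α r) = r := by
  obtain ⟨⟨hc, hm, h0⟩, ht⟩ := hα
  let e : ℝ → ℝ := fun r => α (max r 0) + min r 0
  have he : ∀ r, 0 ≤ r → e r = α r := fun r hr => by simp [e, hr]
  have he' : ∀ r, r ≤ 0 → e r = r := fun r hr => by simp [e, hr, h0]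
  have hec : Continuous e :=
    (hc.comp_continuous (by fun_prop : Continuous fun r : ℝ => max r 0)
      fun r => le_max_right r 0).add (by fun_prop)
  have hmono : StrictMono e := by
    intro r s hrs
    rcases le_or_gt 0 r with hr | hr
    · rw [he r hr, he s (hr.trans hrs.le)]
      exact hm hr (hr.trans hrs.le) hrs
    · rw [he' r hr.le]
      rcases le_total 0 s with hs | hs
      · rw [he s hs]
        have := hm.monotoneOn self_mem_Ici hs hs
        linarith
      · rwa [he' s hs]
  have hsurj : Function.Surjective e := by
    refine hec.surjective (ht.congr' ?_) (tendsto_id.congr' ?_)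
    · filter_upwards [eventually_ge_atTop 0] with r hr using (he r hr).symm
    · filter_upwards [eventually_le_atBot 0] with r hr using (he' r hr).symm
  let E := hmono.orderIsoOfSurjective e hsurj
  have hE : ∀ r, E r = e r := fun _ => rfl
  refine ⟨E.symm, E.symm.continuous, E.symm.strictMono, ?_, fun r hr => ?_⟩
  · rw [E.symm_apply_eq, hE, he' 0 le_rfl]
  · rw [E.symm_apply_eq, hE, he r hr]

theorem IsSolution₀.exists_curve {Δ : ℝ≥0} {n : ℕ} {f₀ : Hist Δ n → Vec n} {x₀ : Hist Δ n}
    {tmax : EReal} {x : ℝ → Vec n} (h : IsSolution₀ Δ f₀ x₀ tmax x) {b : ℝ} (hb : 0 ≤ b)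
    (hbt : (b : EReal) < tmax) :
    ∃ y : C(ℝ, Vec n), EqOn x y (Icc (-(Δ : ℝ)) b) ∧
      (∀ t ∈ Icc 0 b, seg Δ x t = histCurve Δ y t) ∧
      ∀ t ∈ Icc 0 b, y t = x 0 + ∫ s in (0 : ℝ)..t, f₀ (histCurve Δ y s) := by
  have hD : -(Δ : ℝ) ≤ 0 := neg_nonpos.2 Δ.coe_nonneg
  have hsub : Icc (-(Δ : ℝ)) b ⊆ {s : ℝ | -(Δ : ℝ) ≤ s ∧ (s : EReal) < tmax} := fun s hs =>
    ⟨hs.1, (EReal.coe_le_coe_iff.2 hs.2).trans_lt hbt⟩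
  let y : C(ℝ, Vec n) := ⟨IccExtend (hD.trans hb) ((Icc (-(Δ : ℝ)) b).domRestrict x),
    (h.cont.mono hsub).domRestrict.Icc_extend'⟩
  have hxy : EqOn x y (Icc (-(Δ : ℝ)) b) := fun s hs =>
    (IccExtend_of_mem (hD.trans hb) ((Icc (-(Δ : ℝ)) b).domRestrict x) hs).symm
  have hseg : ∀ t ∈ Icc 0 b, seg Δ x t = histCurve Δ y t := fun t ht =>
    seg_eq_histCurve (hxy.mono (Icc_subset_Icc (by linarith [ht.1]) ht.2))
  refine ⟨y, hxy, hseg, fun t ht => ?_⟩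
  rw [← hxy ⟨hD.trans ht.1, ht.2⟩,
    h.integral_eq t ht.1 ((EReal.coe_le_coe_iff.2 ht.2).trans_lt hbt)]
  congr 1
  refine intervalIntegral.integral_congr fun s hs => ?_
  rw [uIcc_of_le ht.1] at hs
  exact congrArg f₀ (hseg s ⟨hs.1, hs.2.trans ht.2⟩)

/-- Along solutions, a Lyapunov–Halanay function decays linearly up to any positive level. -/
theorem IsSolution₀.lyapunov_le {Δ : ℝ≥0} {n : ℕ} {f₀ : Hist Δ n → Vec n}
    (hf : LipOnBounded₀ f₀) {V : Vec n → ℝ} (hV : ContDiff ℝ 1 V)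
    (hVnonneg : ∀ z : Vec n, 0 ≤ V z) {α γ g : ℝ → ℝ} (hγ : ClassK γ)
    (hHal : ∀ φ : Hist Δ n,
      fderiv ℝ V (ev0 φ) (f₀ φ)
        ≤ -α (V (ev0 φ)) + γ (⨆ τ : Icc (-(Δ : ℝ)) (0 : ℝ), V (φ τ)))
    (hg : ∀ s, 0 < s → 0 < g s ∧ ∀ κ ∈ Icc 0 (g s), γ (s + κ * Δ) + κ < α s)
    {x₀ : Hist Δ n} {tmax : EReal} {x : ℝ → Vec n} (h : IsSolution₀ Δ f₀ x₀ tmax x)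
    {M ε κ : ℝ} (hM : ∀ τ, V (x₀ τ) ≤ M) (hε : 0 < ε) (hκ : 0 ≤ κ)
    (hκg : ∀ s ∈ Icc ε (max ε M), κ ≤ g s) {t : ℝ} (ht : 0 ≤ t) (htm : (t : EReal) < tmax) :
    V (x t) ≤ max ε (M - κ * t) := by
  obtain ⟨y, hxy, -, hy⟩ := h.exists_curve ht htm
  have hD : -(Δ : ℝ) ≤ 0 := neg_nonpos.2 Δ.coe_nonneg
  rw [hxy ⟨hD.trans ht, le_rfl⟩]
  have hcont : Continuous fun s => f₀ (histCurve Δ y s) :=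
    hf.continuous.comp (histCurve Δ y).continuous
  have hder : ∀ s ∈ Ico 0 t, HasDerivWithinAt y (f₀ (histCurve Δ y s)) (Ici s) s := by
    intro s hs
    have h1 : HasDerivAt (fun u => x 0 + ∫ r in (0 : ℝ)..u, f₀ (histCurve Δ y r))
        (f₀ (histCurve Δ y s)) s :=
      (intervalIntegral.integral_hasDerivAt_right (hcont.intervalIntegrable _ _)
        (hcont.stronglyMeasurableAtFilter _ _) hcont.continuousAt).const_add _
    refine h1.hasDerivWithinAt.congr_of_eventuallyEq ?_ (hy s ⟨hs.1, hs.2.le⟩)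
    filter_upwards [Ico_mem_nhdsGE hs.2] with u hu
    exact hy u ⟨hs.1.trans hu.1, hu.2.le⟩
  have hev : ∀ s, ev0 (histCurve Δ y s) = y s := fun s => by simp [ev0, histCurve_apply]
  refine halanay_linear_decay (Δ := Δ) (w := fun s => V (y s))
    (w' := fun s => fderiv ℝ V (y s) (f₀ (histCurve Δ y s))) hg
    (hV.continuous.comp y.continuous).continuousOn (fun s hs => ?_) (fun s hs m hm => ?_)
    (fun s hs => ?_) hε hκ hκg t ⟨ht, le_rfl⟩
  · exact ((hV.differentiable one_ne_zero (y s)).hasFDerivAt.comp_hasDerivWithinAt s (hder s hs))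
  · have h1 := hHal (histCurve Δ y s)
    rw [hev] at h1
    have : Nonempty (Icc (-(Δ : ℝ)) (0 : ℝ)) := ⟨⟨0, zero_mem_IccD Δ⟩⟩
    have hsup : ⨆ τ : Icc (-(Δ : ℝ)) (0 : ℝ), V (histCurve Δ y s τ) ≤ m :=
      ciSup_le fun τ => hm _ ⟨by linarith [τ.2.1], by linarith [τ.2.2]⟩
    have hsup0 : 0 ≤ ⨆ τ : Icc (-(Δ : ℝ)) (0 : ℝ), V (histCurve Δ y s τ) :=
      Real.iSup_nonneg fun τ => hVnonneg _
    have := hγ.2.1.monotoneOn (mem_Ici.2 hsup0) (mem_Ici.2 (hsup0.trans hsup)) hsup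
    linarith
  · rw [← hxy ⟨hs.1, hs.2.trans ht⟩, h.init ⟨s, hs⟩]
    exact hM _

/-- Bounded maximal solutions are global. -/
theorem IsMaxSolution₀.eq_top_of_bounded {Δ : ℝ≥0} {n : ℕ} {f₀ : Hist Δ n → Vec n}
    (hf : LipOnBounded₀ f₀) {x₀ : Hist Δ n} {tmax : EReal} {x : ℝ → Vec n}
    (h : IsMaxSolution₀ Δ f₀ x₀ tmax x) {R : ℝ} (hR : 0 < R)
    (hbd : ∀ t : ℝ, -(Δ : ℝ) ≤ t → (t : EReal) < tmax → ‖x t‖ ≤ R) : tmax = ⊤ := by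
  by_contra hne
  have hsol : IsSolution₀ Δ f₀ x₀ tmax x := h.1
  have hD : -(Δ : ℝ) ≤ 0 := neg_nonpos.2 Δ.coe_nonneg
  lift tmax to ℝ using ⟨hne, hsol.tmax_pos.ne_bot⟩ with T
  have hT : 0 < T := EReal.coe_pos.1 hsol.tmax_pos
  simp only [EReal.coe_lt_coe_iff] at hbd
  obtain ⟨C, hC0, hC⟩ := hf.exists_bound hR
  set G : ℝ → Vec n := fun s => f₀ (seg Δ x s)
  have hGcont : ContinuousOn G (Ico 0 T) := by
    intro t ht
    obtain ⟨b, htb, hbT⟩ := exists_between ht.2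
    obtain ⟨y, -, hseg, -⟩ := hsol.exists_curve (ht.1.trans htb.le) (EReal.coe_lt_coe_iff.2 hbT)
    have h1 : ContinuousWithinAt (fun s => f₀ (histCurve Δ y s)) (Ico 0 T) t :=
      (hf.continuous.comp (histCurve Δ y).continuous).continuousWithinAt
    refine h1.congr_of_eventuallyEq ?_ (congrArg f₀ (hseg t ⟨ht.1, htb.le⟩))
    filter_upwards [self_mem_nhdsWithin, mem_nhdsWithin_of_mem_nhds (Iio_mem_nhds htb)]
      with s hs hsb
    exact congrArg f₀ (hseg s ⟨hs.1, le_of_lt hsb⟩)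
  have hGbd : ∀ s ∈ Ico 0 T, ‖G s‖ ≤ C := by
    intro s hs
    obtain ⟨y, hxy, hseg, -⟩ := hsol.exists_curve hs.1 (EReal.coe_lt_coe_iff.2 hs.2)
    refine hC _ ?_
    rw [hseg s ⟨hs.1, le_rfl⟩]
    refine (ContinuousMap.norm_le _ hR.le).2 fun τ => ?_
    have h1 : -(Δ : ℝ) ≤ s + τ.1 := by linarith [τ.2.1, hs.1]
    have h2 : s + τ.1 ≤ s := by linarith [τ.2.2]
    rw [histCurve_apply, ← hxy ⟨h1, h2⟩]
    exact hbd _ h1 (h2.trans_lt hs.2)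
  have hGint : IntegrableOn G (Icc 0 T) := by
    rw [integrableOn_Icc_iff_integrableOn_Ico]
    refine Integrable.of_bound (hGcont.aestronglyMeasurable measurableSet_Ico) C ?_
    exact (ae_restrict_iff' measurableSet_Ico).2 (Eventually.of_forall hGbd)
  have hprim : ContinuousOn (fun t => x 0 + ∫ s in (0 : ℝ)..t, G s) (Icc 0 T) := by
    have := intervalIntegral.continuousOn_primitive_interval (by rwa [uIcc_of_le hT.le])
    rw [uIcc_of_le hT.le] at this
    exact continuousOn_const.add this
  set c : Vec n := x 0 + ∫ s in (0 : ℝ)..T, G s with hc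
  let X : ℝ → Vec n := fun t => if t < T then x t else c
  have hXx : ∀ t < T, X t = x t := fun t ht => if_pos ht
  have hXT : X T = c := if_neg (lt_irrefl T)
  have hXprim : ∀ t ∈ Icc 0 T, X t = x 0 + ∫ s in (0 : ℝ)..t, G s := by
    intro t ht
    rcases ht.2.lt_or_eq with h1 | h1
    · rw [hXx t h1]
      exact hsol.integral_eq t ht.1 (EReal.coe_lt_coe_iff.2 h1)
    · rw [h1, hXT]
  have hXcont : ContinuousOn X (Icc (-(Δ : ℝ)) T) := by
    intro t ht
    rcases ht.2.lt_or_eq with h1 | h1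
    · have h2 : ContinuousWithinAt x (Icc (-(Δ : ℝ)) T) t := by
        refine (hsol.cont t ⟨ht.1, EReal.coe_lt_coe_iff.2 h1⟩).mono_of_mem_nhdsWithin ?_
        filter_upwards [self_mem_nhdsWithin, mem_nhdsWithin_of_mem_nhds (Iio_mem_nhds h1)]
          with s hs hsT using ⟨hs.1, EReal.coe_lt_coe_iff.2 hsT⟩
      refine h2.congr_of_eventuallyEq ?_ (hXx t h1)
      filter_upwards [mem_nhdsWithin_of_mem_nhds (Iio_mem_nhds h1)] with s hs using hXx s hs
    · subst h1
      refine ((hprim t ⟨hT.le, le_rfl⟩).congr hXprim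
        (hXprim t ⟨hT.le, le_rfl⟩)).mono_of_mem_nhdsWithin ?_
      filter_upwards [self_mem_nhdsWithin, mem_nhdsWithin_of_mem_nhds (Ioi_mem_nhds hT)]
        with s hs hs0 using ⟨le_of_lt hs0, hs.2⟩
  let φ : Hist Δ n := ⟨fun τ => X (T + τ.1), hXcont.comp_continuous (by fun_prop) fun τ =>
    ⟨by linarith [τ.2.1], by linarith [τ.2.2]⟩⟩
  obtain ⟨δ, hδ, y, hyφ, hy⟩ := exists_local_solution hf φ
  have hev : ev0 φ = c := by
    change X (T + 0) = c
    rw [add_zero, hXT]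
  let Y : ℝ → Vec n := fun t => if t ≤ T then X t else y (t - T)
  have hYx : ∀ t < T, Y t = x t := fun t ht => (if_pos ht.le).trans (hXx t ht)
  have hYX : EqOn Y X (Icc (-(Δ : ℝ)) T) := fun t ht => if_pos ht.2
  have hYy : ∀ t, T - (Δ : ℝ) ≤ t → Y t = y (t - T) := by
    intro t ht
    by_cases h1 : t ≤ T
    · have h2 : y (t - T) = X (T + (t - T)) := hyφ ⟨t - T, by linarith, by linarith⟩
      rw [add_sub_cancel] at h2
      exact (if_pos h1).trans h2.symm
    · exact if_neg h1
  have hsegx : ∀ t, 0 ≤ t → t < T → seg Δ Y t = seg Δ x t := by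
    intro t ht htT
    obtain ⟨z, hxz, hseg, -⟩ := hsol.exists_curve ht (EReal.coe_lt_coe_iff.2 htT)
    rw [hseg t ⟨ht, le_rfl⟩]
    refine seg_eq_histCurve fun s hs => ?_
    rw [hYx s (hs.2.trans_lt htT)]
    exact hxz ⟨by linarith [hs.1], hs.2⟩
  have hsegy : ∀ t, T ≤ t → seg Δ Y t = histCurve Δ y (t - T) := by
    intro t ht
    have h1 : seg Δ Y t = histCurve Δ (y.comp ⟨fun s => s - T, by fun_prop⟩) t :=
      seg_eq_histCurve fun s hs => hYy s (by linarith [hs.1])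
    rw [h1]
    ext1 τ
    rw [histCurve_apply, histCurve_apply, sub_add_eq_add_sub]
    rfl
  set G' : ℝ → Vec n := fun s => f₀ (seg Δ Y s)
  have hgy : Continuous fun s => f₀ (histCurve Δ y s) :=
    hf.continuous.comp (histCurve Δ y).continuous
  have hG'G : EqOn G G' (Ico 0 T) := fun s hs => congrArg f₀ (hsegx s hs.1 hs.2).symm
  have hG'y : EqOn (fun s => f₀ (histCurve Δ y (s - T))) G' (Ici T) := fun s hs =>
    congrArg f₀ (hsegy s hs).symm
  have hae : ∀ t, t ≤ T → 0 ≤ t → IntervalIntegrable G' volume 0 t ∧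
      ∫ s in (0 : ℝ)..t, G' s = ∫ s in (0 : ℝ)..t, G s := by
    intro t ht ht0
    have hIoo : EqOn G G' (Ioo 0 t) := fun s hs => hG'G ⟨hs.1.le, hs.2.trans_le ht⟩
    constructor
    · rw [intervalIntegrable_iff_integrableOn_Ioo_of_le ht0]
      exact (hGint.mono_set (Ioo_subset_Icc_self.trans (Icc_subset_Icc_right ht))).congr_fun hIoo
        measurableSet_Ioo
    · rw [intervalIntegral.integral_of_le ht0, intervalIntegral.integral_of_le ht0,
        integral_Ioc_eq_integral_Ioo, integral_Ioc_eq_integral_Ioo]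
      exact (setIntegral_congr_fun measurableSet_Ioo hIoo).symm
  have hafter : ∀ t, T ≤ t → IntervalIntegrable G' volume T t ∧
      ∫ s in T..t, G' s = ∫ s in (0 : ℝ)..(t - T), f₀ (histCurve Δ y s) := by
    intro t ht
    have hEq : EqOn (fun s => f₀ (histCurve Δ y (s - T))) G' (uIcc T t) := fun s hs => by
      rw [uIcc_of_le ht] at hs
      exact hG'y hs.1
    constructor
    · exact ((hgy.comp (continuous_id.sub continuous_const)).intervalIntegrable T t).congr
        (hEq.mono uIoc_subset_uIcc)
    · rw [← intervalIntegral.integral_congr hEq,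
        intervalIntegral.integral_comp_sub_right (fun s => f₀ (histCurve Δ y s)), sub_self]
  have hY0 : Y 0 = x 0 := hYx 0 hT
  have hext : IsSolution₀ Δ f₀ x₀ ((T + δ : ℝ) : EReal) Y := by
    refine ⟨EReal.coe_pos.2 (by positivity), ?_, fun τ => ?_, fun t ht htm => ?_, fun t ht htm => ?_⟩
    · have h1 : ContinuousOn Y (Icc (-(Δ : ℝ)) T) := hXcont.congr hYX
      have h2 : ContinuousOn Y (Ici T) :=
        (y.continuous.comp (continuous_id.sub continuous_const)).continuousOn.congr fun s hs =>
          hYy s ((sub_le_self _ Δ.coe_nonneg).trans hs)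
      refine (h1.union_of_isClosed h2 isClosed_Icc isClosed_Ici).mono fun s hs => ?_
      rcases le_total s T with h3 | h3
      · exact Or.inl ⟨hs.1, h3⟩
      · exact Or.inr h3
    · rw [hYx _ (τ.2.2.trans_lt hT)]
      exact hsol.init τ
    · rcases le_total t T with h1 | h1
      · exact (hae t h1 ht).1
      · exact (hae T le_rfl hT.le).1.trans (hafter t h1).1
    · change Y t = Y 0 + ∫ s in (0 : ℝ)..t, G' s
      rw [hY0]
      rcases le_total t T with h1 | h1
      · rw [(hae t h1 ht).2, hYX ⟨hD.trans ht, h1⟩, hXprim t ⟨ht, h1⟩]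
      · rw [← intervalIntegral.integral_add_adjacent_intervals (hae T le_rfl hT.le).1
          (hafter t h1).1, (hae T le_rfl hT.le).2, (hafter t h1).2, ← add_assoc, ← hc, ← hev,
          hYy t ((sub_le_self _ Δ.coe_nonneg).trans h1)]
        exact hy _ ⟨sub_nonneg.2 h1, by linarith [EReal.coe_lt_coe_iff.1 htm]⟩
  have hle := h.2 _ Y hext fun t _ ht => hYx t (EReal.coe_lt_coe_iff.1 ht)
  linarith [EReal.coe_le_coe_iff.1 hle]

/-- GAS through a nonlinear Halanay inequality. -/
theorem gas_halanay
    (Δ : ℝ≥0) (n : ℕ) (f₀ : Hist Δ n → Vec n)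
    (hf : LipOnBounded₀ f₀) (hf0 : f₀ 0 = 0)
    (V : Vec n → ℝ) (hV : ContDiff ℝ 1 V) (hVnonneg : ∀ z : Vec n, 0 ≤ V z)
    (α₁ α₂ : ℝ → ℝ) (hα₁ : ClassKinf α₁) (hα₂ : ClassKinf α₂)
    (hsand : ∀ z : Vec n, α₁ ‖z‖ ≤ V z ∧ V z ≤ α₂ ‖z‖)
    (α : ℝ → ℝ) (hα : ClassP α) (γ : ℝ → ℝ) (hγ : ClassK γ)
    (hHal : ∀ φ : Hist Δ n,
      fderiv ℝ V (ev0 φ) (f₀ φ)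
        ≤ -α (V (ev0 φ)) + γ (⨆ τ : Icc (-(Δ : ℝ)) (0 : ℝ), V (φ τ)))
    (hαγ : ClassP fun s => α s - γ s) :
    GAS Δ f₀ := by
  obtain ⟨g, hg, hg0, hgz, hgrate⟩ := exists_decay_rate Δ hα hγ hαγ
  obtain ⟨ψ, hψM, hψt, hψz, hψ0, hψmono, hψanti, hψlim, hψmaj⟩ :=
    exists_decay_majorant hg hg0 hgz fun s hs => (hgrate s hs).1
  obtain ⟨a, ha, hamono, ha0, hainv⟩ := hα₁.exists_inverse
  have hα₂0 : ∀ s, 0 ≤ s → 0 ≤ α₂ s := fun s hs =>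
    hα₂.1.2.2 ▸ hα₂.1.2.1.monotoneOn self_mem_Ici hs hs
  have hnorm : ∀ z v, V z ≤ v → ‖z‖ ≤ a v := fun z v hz => by
    rw [← hainv ‖z‖ (norm_nonneg z)]
    exact hamono.monotone ((hsand z).1.trans hz)
  refine ⟨fun s t => a (ψ (α₂ s) t) + s * Real.exp (-t), ⟨fun t ht => ⟨?_, ?_, ?_⟩,
    fun s hs => ⟨?_, ?_, ?_⟩⟩, fun x₀ tmax x hx => ?_⟩
  · exact (ha.comp_continuousOn ((hψM t).comp_continuousOn hα₂.1.1)).add (by fun_prop)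
  · intro s₁ hs₁ s₂ hs₂ h12
    refine add_lt_add_of_le_of_lt (hamono.monotone (hψmono t ht (hα₂0 s₁ hs₁) (hα₂0 s₂ hs₂)
      (hα₂.1.2.1 hs₁ hs₂ h12).le)) (mul_lt_mul_of_pos_right h12 (Real.exp_pos _))
  · simp [hα₂.1.2.2, hψz, ha0]
  · exact ((ha.comp (hψt _)).add (by fun_prop)).continuousOn
  · intro t₁ _ t₂ _ h12
    refine add_le_add (hamono.monotone (hψanti _ (hα₂0 s hs) h12)) ?_
    exact mul_le_mul_of_nonneg_left (Real.exp_le_exp.2 (neg_le_neg h12)) hs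
  · have h1 : Tendsto (fun t => a (ψ (α₂ s) t)) atTop (𝓝 (a 0)) :=
      (ha.tendsto 0).comp (hψlim _ (hα₂0 s hs))
    have h2 := Real.tendsto_exp_neg_atTop_nhds_zero.const_mul s
    simpa [ha0] using h1.add h2
  · have hsol : IsSolution₀ Δ f₀ x₀ tmax x := hx.1
    set M := α₂ ‖x₀‖
    have hM : ∀ τ, V (x₀ τ) ≤ M := fun τ => (hsand _).2.trans
      (hα₂.1.2.1.monotoneOn (norm_nonneg _) (norm_nonneg x₀) (x₀.norm_coe_le_norm τ))
    have hM0 : 0 ≤ M := hα₂0 _ (norm_nonneg _)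
    have hdecay : ∀ t : ℝ, 0 ≤ t → (t : EReal) < tmax → ∀ ε κ, 0 < ε → 0 ≤ κ →
        (∀ s ∈ Icc ε (max ε M), κ ≤ g s) → V (x t) ≤ max ε (M - κ * t) :=
      fun t ht htm ε κ hε hκ hκg =>
        hsol.lyapunov_le hf hV hVnonneg hγ hHal hgrate hM hε hκ hκg ht htm
    have hVM : ∀ t : ℝ, 0 ≤ t → (t : EReal) < tmax → V (x t) ≤ M := by
      refine fun t ht htm => le_of_forall_pos_le_add fun ε hε => ?_
      refine (hdecay t ht htm ε 0 hε le_rfl fun s _ => hg0 s).trans (max_le ?_ ?_) <;> linarith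
    have htop : tmax = ⊤ := by
      refine hx.eq_top_of_bounded hf (R := a M + 1) ?_ fun t htD htm => ?_
      · linarith [(norm_nonneg _).trans (hnorm 0 _ ((hsand 0).2.trans (by
          simpa [hα₂.1.2.2] using hM0)))]
      · have : V (x t) ≤ M := by
          rcases le_total 0 t with h0 | h0
          · exact hVM t h0 htm
          · rw [hsol.init ⟨t, htD, h0⟩]
            exact hM _
        linarith [hnorm _ _ this]
    refine ⟨htop, fun t ht => ?_⟩
    have htm : (t : EReal) < tmax := htop ▸ EReal.coe_lt_top t
    refine (hnorm _ _ (hψmaj M t (V (x t)) hM0 ht (hVM t ht htm)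
      fun ε κ hε hεM hκ hκg => hdecay t ht htm ε κ hε hκ (by rwa [max_eq_right hεM]))).trans ?_
    exact le_add_of_nonneg_right (by positivity)
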